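/- A natural number N is a sum of three squares of natural numbers if and only if N is not of the form 4^i(8j+7) for natural numbers i, j ≥ 0. Consequently, n! is a sum of three squares if and only if it is NOT the case that (ν₂(n!) is even and g(n!) ≡ 7 (mod 8)). -/

import Mathlib

open scoped Nat

/-- The odd part of `n`. -/
def oddPart (n : ℕ) : ℕ := n / 2 ^ padicValNat 2 n

open NumberTheorySymbols in
/-- If `r * p ≡ -1 (mod b)`, then `-b` is a quadratic residue modulo the prime `p`, provided `-r` has
Jacobi symbol `1` modulo `b` and `p ≡ 1 (mod 4)` or `b ≡ 3 (mod 4)`. -/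
theorem exists_dvd_sq_add_of_jacobiSym_neg {p b r N : ℕ} (hp : p.Prime) (hp2 : p % 2 = 1)
    (hb2 : b % 2 = 1) (hpb : p % 4 = 1 ∨ b % 4 = 3) (h : r * p + 1 = b * N)
    (hr : J(-(r : ℤ) | b) = 1) : ∃ y : ℤ, (p : ℤ) ∣ y ^ 2 + b := by
  have := Fact.mk hp
  have hpo : Odd p := Nat.odd_iff.mpr hp2
  have hbo : Odd b := Nat.odd_iff.mpr hb2
  have hpJ : J((p : ℤ) | b) = 1 := by
    have h1 : J(-(r : ℤ) * p | b) = 1 := by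
      rw [← jacobiSym.one_left b]
      apply jacobiSym.mod_left'
      rw [show -(r : ℤ) * p = 1 + b * (-N) by linear_combination -(by exact_mod_cast h :
        (r : ℤ) * p + 1 = b * N)]
      simp
    rwa [jacobiSym.mul_left, hr, one_mul] at h1
  have hJ : J(-(b : ℤ) | p) = 1 := by
    rw [jacobiSym.neg _ hpo]
    rcases (by omega : p % 4 = 1 ∨ p % 4 = 3) with h4 | h4
    · rw [ZMod.χ₄_nat_one_mod_four h4, one_mul,
        jacobiSym.quadratic_reciprocity_one_mod_four' hbo h4, hpJ]
    · rw [ZMod.χ₄_nat_three_mod_four h4,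
        jacobiSym.quadratic_reciprocity_three_mod_four (by omega) h4, hpJ]
      norm_num
  obtain ⟨z, hz⟩ := ZMod.isSquare_of_jacobiSym_eq_one hJ
  obtain ⟨y, rfl⟩ := ZMod.intCast_surjective z
  refine ⟨y, (ZMod.intCast_zmod_eq_zero_iff_dvd _ p).mp ?_⟩
  push_cast at hz ⊢
  linear_combination -hz

theorem exists_abs_two_mul_add_mul_le {a : ℤ} (ha : 0 < a) (f : ℤ) :
    ∃ k : ℤ, |2 * (f + k * a)| ≤ a := by
  refine ⟨-((2 * f + a) / (2 * a)), ?_⟩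
  have h1 := Int.emod_add_mul_ediv (2 * f + a) (2 * a)
  have h2 := Int.emod_nonneg (2 * f + a) (by omega : 2 * a ≠ 0)
  have h3 := Int.emod_lt_of_pos (2 * f + a) (by omega : 0 < 2 * a)
  rw [abs_le]
  constructor <;> nlinarith

/-- A reduced positive definite ternary form of determinant one has leading coefficients one. -/
theorem eq_one_of_reduced_ternary {a g b f g₁ g₂ : ℤ} (ha : 0 < a) (hg : 0 < g)
    (hgab : g = a * b - f ^ 2) (hdet : g * g₂ - g₁ ^ 2 = a) (hf : |2 * f| ≤ a) (hg₁ : |2 * g₁| ≤ g)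
    (hab : a ≤ b) (hgg : g ≤ g₂) : a = 1 ∧ g = 1 ∧ g₁ = 0 ∧ g₂ = 1 := by
  have hf2 : (2 * f) ^ 2 ≤ a ^ 2 := sq_le_sq' (abs_le.mp hf).1 (abs_le.mp hf).2
  have hg2 : (2 * g₁) ^ 2 ≤ g ^ 2 := sq_le_sq' (abs_le.mp hg₁).1 (abs_le.mp hg₁).2
  have h1 : 3 * a ^ 2 ≤ 4 * g := by nlinarith
  have h2 : 3 * g ^ 2 ≤ 4 * a := by nlinarith
  have ha1 : a = 1 := by
    by_contra hne
    have ha2 : 2 ≤ a := by omega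
    have hg3 : 3 ≤ g := by nlinarith
    nlinarith [mul_nonneg (sub_nonneg.mpr ha2) (sub_nonneg.mpr hg3)]
  subst ha1
  have hg1 : g = 1 := by nlinarith
  subst hg1
  have h0 : g₁ = 0 := by
    have := abs_le.mp hg₁
    omega
  subst h0
  exact ⟨rfl, rfl, rfl, by linarith⟩

/-- Every integer represented by a positive definite integral ternary form
`a x² + b y² + c z² + 2 d y z + 2 e x z + 2 f x y` of determinant one is a sum of three squares. -/
theorem sum_three_squares_of_ternary_det_one (a b c d e f : ℤ) (ha : 0 < a)
    (hg : 0 < a * b - f ^ 2)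
    (hdet : (a * b - f ^ 2) * (a * c - e ^ 2) - (a * d - e * f) ^ 2 = a) (x y z : ℤ) :
    ∃ u v w : ℤ, a * x ^ 2 + b * y ^ 2 + c * z ^ 2 + 2 * d * y * z + 2 * e * x * z + 2 * f * x * y
      = u ^ 2 + v ^ 2 + w ^ 2 := by
  obtain ⟨k, hk⟩ := exists_abs_two_mul_add_mul_le hg (a * d - e * f)
  -- Substitute `y ↦ y + k z`.
  obtain ⟨c', hc'⟩ : ∃ c', c' = c + 2 * k * d + k ^ 2 * b := ⟨_, rfl⟩
  obtain ⟨d', hd'⟩ : ∃ d', d' = d + k * b := ⟨_, rfl⟩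
  obtain ⟨e', he'⟩ : ∃ e', e' = e + k * f := ⟨_, rfl⟩
  obtain ⟨l, hl⟩ := exists_abs_two_mul_add_mul_le ha f
  -- Substitute `x ↦ x + l y`.
  obtain ⟨b', hb'⟩ : ∃ b', b' = b + 2 * l * f + l ^ 2 * a := ⟨_, rfl⟩
  obtain ⟨d'', hd''⟩ : ∃ d'', d'' = d' + l * e' := ⟨_, rfl⟩
  obtain ⟨f', hf'⟩ : ∃ f', f' = f + l * a := ⟨_, rfl⟩
  have hgg : a * b' - f' ^ 2 = a * b - f ^ 2 := by subst_vars; ring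
  have hg₁ : a * d'' - e' * f' = a * d - e * f + k * (a * b - f ^ 2) := by subst_vars; ring
  have hdet' : (a * b' - f' ^ 2) * (a * c' - e' ^ 2) - (a * d'' - e' * f') ^ 2 = a := by
    subst_vars; linear_combination hdet
  obtain ⟨y', hy'⟩ : ∃ y', y' = y - k * z := ⟨_, rfl⟩
  obtain ⟨x', hx'⟩ : ∃ x', x' = x - l * y' := ⟨_, rfl⟩
  have hval : a * x ^ 2 + b * y ^ 2 + c * z ^ 2 + 2 * d * y * z + 2 * e * x * z + 2 * f * x * y
      = a * x' ^ 2 + b' * y' ^ 2 + c' * z ^ 2 + 2 * d'' * y' * z + 2 * e' * x' * z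
        + 2 * f' * x' * y' := by subst_vars; ring
  rw [hval]
  have hg' : 0 < a * b' - f' ^ 2 := by rw [hgg]; exact hg
  rw [← hg₁, ← hgg] at hk
  rw [← hf'] at hl
  have hb0 : 0 < b' := by
    by_contra! hneg
    nlinarith [sq_nonneg f']
  have hg₂ : 0 < a * c' - e' ^ 2 := by
    by_contra! hneg
    nlinarith [sq_nonneg (a * d'' - e' * f')]
  by_cases hab : a ≤ b'
  · by_cases hgc : a * b' - f' ^ 2 ≤ a * c' - e' ^ 2
    · obtain ⟨h1, h2, h3, h4⟩ := eq_one_of_reduced_ternary ha hg' rfl hdet' hl hk hab hgc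
      refine ⟨x' + f' * y' + e' * z, y', z, ?_⟩
      subst h1
      linear_combination y' ^ 2 * h2 + 2 * y' * z * h3 + z ^ 2 * h4
    · obtain ⟨u, v, w, h⟩ := sum_three_squares_of_ternary_det_one a c' b' d'' f' e' ha hg₂
        (by linear_combination hdet') x' z y'
      exact ⟨u, v, w, by rw [← h]; ring⟩
  · have hdet1 : a * (a * b' * c' + 2 * d'' * e' * f' - a * d'' ^ 2 - b' * e' ^ 2 - c' * f' ^ 2)
        = a * 1 := by linear_combination hdet'
    have hdet2 := mul_left_cancel₀ ha.ne' hdet1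
    obtain ⟨u, v, w, h⟩ := sum_three_squares_of_ternary_det_one b' a c' e' d'' f' hb0
      (by linarith) (by linear_combination b' * hdet2) y' x' z
    exact ⟨u, v, w, by rw [← h]; ring⟩
termination_by (a.toNat, (a * b - f ^ 2).toNat)
decreasing_by
  · apply Prod.Lex.right
    omega
  · apply Prod.Lex.left
    omega

/-- Dirichlet's criterion: it suffices that `-b` be a square modulo `b N - 1` for some `b > 0`. -/
theorem sum_three_squares_of_dvd_sq_add {N b m : ℕ} (hb : 0 < b) (hm : 0 < m)
    (h : m + 1 = b * N) {y : ℤ} (hy : (m : ℤ) ∣ y ^ 2 + b) :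
    ∃ a b c : ℕ, N = a ^ 2 + b ^ 2 + c ^ 2 := by
  obtain ⟨t, ht⟩ := hy
  have hmz : (0 : ℤ) < m := by exact_mod_cast hm
  have hbz : (0 : ℤ) < b := by exact_mod_cast hb
  have hz : (m : ℤ) + 1 = b * N := by exact_mod_cast h
  have ht0 : 0 < t := by
    by_contra! hneg
    nlinarith [sq_nonneg y]
  have hg : t * m - y ^ 2 = b := by linear_combination -ht
  obtain ⟨u, v, w, huvw⟩ := sum_three_squares_of_ternary_det_one t m N 0 1 y ht0 (by rwa [hg])
    (by rw [hg]; linear_combination (-t) * hz - ht) 0 0 1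
  refine ⟨u.natAbs, v.natAbs, w.natAbs, ?_⟩
  zify
  simp only [sq_abs]
  rw [← huvw]
  ring

/-- A positive number that is `2` modulo `4`, or odd and not `7` modulo `8`, is a sum of three
squares. -/
theorem sum_three_squares_of_mod_eight {N : ℕ}
    (h : N % 8 = 1 ∨ N % 8 = 2 ∨ N % 8 = 3 ∨ N % 8 = 5 ∨ N % 8 = 6) :
    ∃ a b c : ℕ, N = a ^ 2 + b ^ 2 + c ^ 2 := by
  have hN : 0 < N := by omega
  by_cases hN2 : N % 2 = 0
  · have hcop : (N - 1).Coprime (4 * N) := by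
      have h1 : (N - 1).Coprime N := by
        rw [Nat.coprime_self_sub_left hN]
        exact Nat.coprime_one_left N
      have h2 : (N - 1).Coprime (2 ^ 2) :=
        Nat.Coprime.pow_right 2 (Nat.coprime_two_right.mpr (Nat.odd_iff.mpr (by omega)))
      exact Nat.Coprime.mul_right h2 h1
    obtain ⟨p, hpN, hp, hmod⟩ := Nat.forall_exists_prime_gt_and_modEq N (by omega) hcop
    obtain ⟨j, hj⟩ := (Nat.modEq_iff_dvd' (by omega)).mp hmod.symm
    have hpj : 1 * p + 1 = (4 * j + 1) * N := by
      have : p = 4 * N * j + (N - 1) := by omega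
      rw [this, show (4 * j + 1) * N = 4 * N * j + N by ring]
      omega
    have hp4 : p % 4 = 1 := by
      have : 4 * N * j = 4 * (N * j) := by ring
      omega
    obtain ⟨y, hy⟩ := exists_dvd_sq_add_of_jacobiSym_neg hp (by omega) (by omega) (Or.inl hp4) hpj
      (by
        rw [Nat.cast_one, jacobiSym.at_neg_one (Nat.odd_iff.mpr (by omega)),
          ZMod.χ₄_nat_one_mod_four (by omega)])
    exact sum_three_squares_of_dvd_sq_add (by omega) hp.pos (by omega) hy
  · obtain ⟨c, q, hc, hq, hqN⟩ : ∃ c q, (c = 1 ∨ c = 3) ∧ 2 * q + 1 = c * N ∧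
        (q % 4 = 1 ∨ q % 4 = 3 ∧ c = 3) := by
      rcases h with h | h | h | h | h
      · exact ⟨3, (3 * N - 1) / 2, by omega⟩
      · omega
      · exact ⟨1, (N - 1) / 2, by omega⟩
      · exact ⟨3, (3 * N - 1) / 2, by omega⟩
      · omega
    have hcop : q.Coprime (4 * N) := by
      have h1 : q.Coprime N := by
        refine Nat.Coprime.coprime_dvd_right (Dvd.intro_left c rfl) ?_
        rw [← hq, Nat.coprime_mul_right_add_right]
        exact Nat.coprime_one_right q
      have h2 : q.Coprime (2 ^ 2) :=
        Nat.Coprime.pow_right 2 (Nat.coprime_two_right.mpr (Nat.odd_iff.mpr (by omega)))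
      exact Nat.Coprime.mul_right h2 h1
    obtain ⟨p, hpq, hp, hmod⟩ := Nat.forall_exists_prime_gt_and_modEq q (by omega) hcop
    obtain ⟨j, hj⟩ := (Nat.modEq_iff_dvd' (by omega)).mp hmod.symm
    have hpeq : p = 4 * (N * j) + q := by
      rw [← mul_assoc]
      omega
    have hpj : 2 * p + 1 = (8 * j + c) * N := by
      rw [hpeq]
      linear_combination hq
    obtain ⟨y, hy⟩ := exists_dvd_sq_add_of_jacobiSym_neg (r := 2) hp (by omega) (by omega)
      (by omega) hpj (by
        rw [Nat.cast_ofNat, jacobiSym.at_neg_two (Nat.odd_iff.mpr (by omega)),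
          ZMod.χ₈'_nat_eq_if_mod_eight]
        rw [if_neg (by omega), if_pos (by omega)])
    -- Adjust the parity of the square root.
    obtain ⟨y', hy', hy2⟩ : ∃ y' : ℤ, (p : ℤ) ∣ y' ^ 2 + ((8 * j + c : ℕ) : ℤ) ∧ y' % 2 = 1 := by
      rcases Int.emod_two_eq_zero_or_one y with h0 | h0
      · refine ⟨y + p, ?_, by omega⟩
        have := dvd_add hy (Dvd.intro (2 * y + p) rfl : (p : ℤ) ∣ p * (2 * y + p))
        rwa [show (y + p) ^ 2 + ((8 * j + c : ℕ) : ℤ) = y ^ 2 + ((8 * j + c : ℕ) : ℤ)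
          + p * (2 * y + p) by ring]
      · exact ⟨y, hy, h0⟩
    refine sum_three_squares_of_dvd_sq_add (b := 8 * j + c) (m := 2 * p) (by omega)
      (by have := hp.pos; omega) hpj (y := y') ?_
    rw [Nat.cast_mul]
    refine IsCoprime.mul_dvd ?_ ?_ hy'
    · exact Nat.isCoprime_iff_coprime.mpr (Nat.coprime_two_left.mpr (Nat.odd_iff.mpr (by omega)))
    · have h1 : y' ^ 2 % 2 = 1 := by
        rw [pow_two, Int.mul_emod, hy2]
        rfl
      omega

theorem ne_four_pow_mul_of_sum_three_squares (i j a b c : ℕ) :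
    a ^ 2 + b ^ 2 + c ^ 2 ≠ 4 ^ i * (8 * j + 7) := by
  have key : ∀ x : ℕ, (x % 2 = 0 ∧ (x ^ 2 % 8 = 0 ∨ x ^ 2 % 8 = 4)) ∨
      (x % 2 = 1 ∧ x ^ 2 % 8 = 1) := by
    intro x
    have h8 : x % 8 < 8 := Nat.mod_lt _ (by norm_num)
    rw [Nat.pow_mod, ← Nat.mod_mod_of_dvd x (by norm_num : 2 ∣ 8)]
    generalize x % 8 = r at h8 ⊢
    interval_cases r <;> simp
  induction i generalizing a b c with
  | zero =>
    intro h
    have := key a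
    have := key b
    have := key c
    omega
  | succ i ih =>
    intro h
    rw [pow_succ 4 i, mul_right_comm] at h
    have ha := key a
    have hb := key b
    have hc := key c
    obtain ⟨a₀, rfl⟩ : 2 ∣ a := by omega
    obtain ⟨b₀, rfl⟩ : 2 ∣ b := by omega
    obtain ⟨c₀, rfl⟩ : 2 ∣ c := by omega
    exact ih a₀ b₀ c₀ (by linarith)

/-- Legendre's three-square theorem. -/
theorem sum_three_squares_iff (N : ℕ) : (∃ a b c : ℕ, N = a ^ 2 + b ^ 2 + c ^ 2) ↔
    ¬ ∃ i j : ℕ, N = 4 ^ i * (8 * j + 7) := by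
  constructor
  · rintro ⟨a, b, c, rfl⟩ ⟨i, j, h⟩
    exact ne_four_pow_mul_of_sum_three_squares i j a b c h
  · induction N using Nat.strong_induction_on with
    | _ N ih =>
      intro h
      rcases Nat.eq_zero_or_pos N with rfl | hN
      · exact ⟨0, 0, 0, rfl⟩
      by_cases h4 : 4 ∣ N
      · obtain ⟨M, rfl⟩ := h4
        obtain ⟨a, b, c, habc⟩ := ih M (by omega) (by
          rintro ⟨i, j, rfl⟩
          exact h ⟨i + 1, j, by ring⟩)
        exact ⟨2 * a, 2 * b, 2 * c, by rw [habc]; ring⟩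
      · have h7 : N % 8 ≠ 7 := fun h7 => h ⟨0, N / 8, by omega⟩
        exact sum_three_squares_of_mod_eight (by omega)

theorem exists_four_pow_mul_iff {m : ℕ} (hm : m ≠ 0) :
    (∃ i j : ℕ, m = 4 ^ i * (8 * j + 7)) ↔ Even (padicValNat 2 m) ∧ oddPart m % 8 = 7 := by
  constructor
  · rintro ⟨i, j, rfl⟩
    have hv : padicValNat 2 (4 ^ i * (8 * j + 7)) = 2 * i := by
      rw [show (4 : ℕ) = 2 ^ 2 from rfl, ← pow_mul,
        padicValNat.mul (by positivity) (by omega), padicValNat.prime_pow,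
        padicValNat.eq_zero_of_not_dvd (by omega), add_zero]
    refine ⟨by rw [hv]; exact even_two_mul i, ?_⟩
    rw [oddPart, hv, pow_mul, show (2 : ℕ) ^ 2 = 4 from rfl,
      Nat.mul_div_cancel_left _ (by positivity)]
    omega
  · rintro ⟨⟨i, hi⟩, h7⟩
    refine ⟨i, oddPart m / 8, ?_⟩
    have hodd : 8 * (oddPart m / 8) + 7 = oddPart m := by omega
    rw [hodd, oddPart, hi, ← two_mul, pow_mul, show (2 : ℕ) ^ 2 = 4 from rfl, Nat.mul_div_cancel']
    have hdvd : 2 ^ padicValNat 2 m ∣ m := pow_padicValNat_dvd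
    rwa [hi, ← two_mul, pow_mul] at hdvd

theorem three_squares_and_factorial :
    (∀ N : ℕ, (∃ a b c : ℕ, N = a ^ 2 + b ^ 2 + c ^ 2) ↔
      ¬ ∃ i j : ℕ, N = 4 ^ i * (8 * j + 7)) ∧
    (∀ n : ℕ, (∃ a b c : ℕ, n ! = a ^ 2 + b ^ 2 + c ^ 2) ↔
      ¬ (Even (padicValNat 2 (n !)) ∧ oddPart (n !) % 8 = 7)) :=
  ⟨sum_three_squares_iff, fun n => by
    rw [sum_three_squares_iff, exists_four_pow_mul_iff n.factorial_ne_zero]⟩
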